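/- The no-return probabilities γ(n) := P(S_i ≠ 0 for i = 1, ..., n-1) satisfy 1 = γ(1) ≥ γ(2) ≥ ⋯ ≥ γ(n) ≥ ⋯ ≥ γ, and moreover there exists a constant C > 0 such that 0 ≤ γ(n) - γ ≤ C (4pq)^{n/2} / n^{3/2} for all n ≥ 1. -/

import Mathlib

open MeasureTheory ProbabilityTheory Filter Set
open scoped ENNReal NNReal

variable {Ω : Type*}

/-- Partial sums of the steps: `S X n = X 0 + ⋯ + X (n-1)` (the walk started at `0`). -/
noncomputable def S (X : ℕ → Ω → ℤ) (n : ℕ) (ω : Ω) : ℤ :=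
  ∑ i ∈ Finset.range n, X i ω

/-- The local time at site `z` up to time `n`: `ξ(z,n) = #{k : 0 < k ≤ n, S_k = z}`. -/
noncomputable def localTime (X : ℕ → Ω → ℤ) (z : ℤ) (n : ℕ) (ω : Ω) : ℕ :=
  ((Finset.Icc 1 n).filter (fun k => S X k ω = z)).card

/-- The maximal local time `ξ(n) = max_{y ∈ ℤ} ξ(y,n)`. -/
noncomputable def maxLocalTime (X : ℕ → Ω → ℤ) (n : ℕ) (ω : Ω) : ℕ :=
  sSup (Set.range fun z : ℤ => localTime X z n ω)

/-- The set of favorite sites at time `n`: `K(n) = {z : ξ(z,n) = ξ(n)}`. -/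
noncomputable def favSites (X : ℕ → Ω → ℤ) (n : ℕ) (ω : Ω) : Set ℤ :=
  {z : ℤ | localTime X z n ω = maxLocalTime X n ω}

/-- The total local time at site `z`: `ξ(z,∞) = #{k > 0 : S_k = z}` (as an extended natural). -/
noncomputable def totalLocalTime (X : ℕ → Ω → ℤ) (z : ℤ) (ω : Ω) : ℕ∞ :=
  {k : ℕ | 0 < k ∧ S X k ω = z}.encard

/-- `X` is a sequence of i.i.d. steps with `P(X_i = 1) = p`, `P(X_i = -1) = q`. -/
def IsAsymmetricSRW [MeasurableSpace Ω] (P : Measure Ω) (X : ℕ → Ω → ℤ) (p q : ℝ) : Prop :=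
  (∀ i, Measurable (X i)) ∧
  iIndepFun X P ∧
  (∀ i, P {ω | X i ω = 1} = ENNReal.ofReal p) ∧
  (∀ i, P {ω | X i ω = -1} = ENNReal.ofReal q)

noncomputable def rwB : ℕ → ℤ → ℝ
  | 0, y => if y = 0 then 1 else 0
  | (m+1), y => (rwB m (y-1) + rwB m (y+1)) / 2

lemma rwB_nonneg (m : ℕ) : ∀ y, 0 ≤ rwB m y := by
  induction m with
  | zero => intro y; simp only [rwB]; split_ifs <;> norm_num
  | succ m ih => intro y; simp only [rwB]; linarith [ih (y-1), ih (y+1)]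

lemma rwB_A (m : ℕ) : ∀ y : ℤ, ((m:ℝ)+1-y) * rwB m (y-1) = ((m:ℝ)+1+y) * rwB m (y+1) := by
  induction m with
  | zero =>
    intro y
    simp only [rwB]
    by_cases h1 : y = 1
    · subst h1; norm_num
    · by_cases h2 : y = -1
      · subst h2; norm_num
      · rw [if_neg (by omega), if_neg (by omega)]; simp
  | succ m ih =>
    intro y
    simp only [rwB]
    have e1 := ih (y-1)
    have e2 := ih (y+1)
    simp only [sub_add_cancel, add_sub_cancel_right] at e1 e2 ⊢
    push_cast at e1 e2 ⊢
    linear_combination e1/2 + e2/2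

lemma rwB_K (m : ℕ) (y : ℤ) :
    ((m:ℝ)+1) * (rwB m (y-1) - rwB m (y+1)) = 2 * y * rwB (m+1) y := by
  have := rwB_A m y
  simp only [rwB]
  linear_combination this

lemma rwB_sq (m : ℕ) : ∀ y : ℤ, ((m:ℝ)+1) * rwB m y ^ 2 ≤ 1 := by
  induction m using Nat.strong_induction_on with
  | _ m ih =>
  intro y
  match m, ih with
  | 0, _ => simp only [rwB]; split_ifs <;> norm_num
  | (m+1), ih =>
    have hA := rwB_A m y
    have hm : (0:ℝ) ≤ m := Nat.cast_nonneg m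
    have key : ∀ b B t : ℝ, 0 ≤ B → 0 ≤ b → 1 ≤ t → ((m:ℝ)+1+t) * B = (m+1) * b → (m+1) * b^2 ≤ 1 →
        ((m:ℝ)+1+1) * B^2 ≤ 1 := by
      intro b B t hB hb ht h1 h2
      have h3 : ((m:ℝ)+2) * B ≤ (m+1) * b := by nlinarith
      have h4 : (((m:ℝ)+2) * B)^2 ≤ ((m+1) * b)^2 := pow_le_pow_left₀ (by positivity) h3 2
      have h5 : ((m:ℝ)+2) * (((m:ℝ)+2) * B^2) ≤ (m+2) * 1 := by nlinarith
      have := le_of_mul_le_mul_left h5 (by positivity)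
      linarith
    push_cast
    rcases lt_trichotomy y 0 with h | h | h
    · have hy : (1:ℝ) ≤ -(y:ℝ) := by
        have : (1:ℤ) ≤ -y := by omega
        exact_mod_cast this
      refine key (rwB m (y+1)) _ (-y) (rwB_nonneg _ _) (rwB_nonneg _ _) hy ?_ (ih m (by omega) _)
      simp only [rwB]; linear_combination hA / 2
    · subst h
      match m, ih with
      | 0, _ => simp [rwB]
      | (k+1), ih =>
        have hk : (0:ℝ) ≤ k := Nat.cast_nonneg k
        have e0 : rwB (k+1) (-1) = rwB (k+1) 1 := by
          have := rwB_A (k+1) 0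
          simp only [Int.cast_zero, sub_zero, add_zero, zero_sub, zero_add] at this
          exact mul_left_cancel₀ (by positivity) this
        have e1 : rwB (k+1+1) 0 = rwB (k+1) 1 := by
          rw [rwB]; simp only [zero_sub, zero_add, e0]; ring
        have e2 : ((k:ℝ)+2) * rwB (k+1) 1 = (k+1) * rwB k 0 := by
          have := rwB_A k 1
          simp only [sub_self] at this
          push_cast at this
          rw [rwB]; simp only [sub_self]; norm_num; linear_combination -this / 2
        have e3 := ih k (by omega) 0
        rw [e1]
        set B := rwB (k+1) 1
        set b := rwB k 0
        have h4 : ((k:ℝ)+2)^2 * B^2 = (k+1) * ((k+1) * b^2) := by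
          rw [← mul_pow, e2]; ring
        have h5 : ((k:ℝ)+2)^2 * B^2 ≤ (k+1) := by nlinarith
        have h6 : ((k:ℝ)+2)^2 * ((k+3) * B^2) ≤ (k+2)^2 * 1 := by nlinarith
        have := le_of_mul_le_mul_left h6 (by positivity)
        push_cast; linarith
    · have hy : (1:ℝ) ≤ (y:ℝ) := by exact_mod_cast h
      refine key (rwB m (y-1)) _ y (rwB_nonneg _ _) (rwB_nonneg _ _) hy ?_ (ih m (by omega) _)
      simp only [rwB]; linear_combination -hA / 2

/-- killed survival function -/
noncomputable def rwG (p q : ℝ) : ℕ → ℤ → ℝ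
  | 0, x => if x = 0 then 0 else 1
  | (m+1), x => if x = 0 then 0 else p * rwG p q m (x+1) + q * rwG p q m (x-1)

lemma rwG_zero (p q : ℝ) (m : ℕ) : rwG p q m 0 = 0 := by
  cases m <;> simp [rwG]

lemma rwG_nonneg {p q : ℝ} (hp : 0 ≤ p) (hq : 0 ≤ q) (m : ℕ) : ∀ x, 0 ≤ rwG p q m x := by
  induction m with
  | zero => intro y; simp only [rwG]; split_ifs <;> norm_num
  | succ m ih =>
    intro y; simp only [rwG]
    have := ih (y-1)
    have := ih (y+1)
    split_ifs
    · exact le_rfl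
    · positivity

lemma rwG_dual {p q : ℝ} (hp : 0 < p) (hpq : p + q = 1) (m : ℕ) :
    ∀ x : ℕ, rwG p q m x = 1 - (q/p)^x + (q/p)^x * rwG p q m (-(x:ℤ)) := by
  induction m with
  | zero =>
    intro x
    cases x with
    | zero => simp [rwG]
    | succ y =>
      simp only [rwG]
      rw [if_neg (by push_cast; omega), if_neg (by push_cast; omega)]; ring
  | succ m ih =>
    intro x
    cases x with
    | zero => simp [rwG]
    | succ y =>
      rw [rwG, rwG, if_neg (by push_cast; omega), if_neg (by push_cast; omega)]
      have e1 : ((y+1 : ℕ):ℤ) + 1 = ((y+2:ℕ):ℤ) := by push_cast; ring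
      have e2 : ((y+1 : ℕ):ℤ) - 1 = (y:ℤ) := by push_cast; ring
      have e3 : -((y+1 : ℕ):ℤ) + 1 = -(y:ℤ) := by push_cast; ring
      have e4 : -((y+1 : ℕ):ℤ) - 1 = -((y+2:ℕ):ℤ) := by push_cast; ring
      rw [e1, e2, e3, e4, ih y, ih (y+2)]
      obtain rfl : q = 1 - p := by linarith
      set A := rwG p (1-p) m (-(y:ℤ))
      set B := rwG p (1-p) m (-((y+2:ℕ):ℤ))
      rw [pow_succ, pow_add]
      set t := ((1-p)/p)^y
      field_simp
      ring

lemma rwG_formula {a c : ℝ} (ha : 0 < a) (hc : 0 < c) (N : ℕ) (m : ℕ) :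
    ∀ x : ℕ, x + m ≤ N → (c/a)^x * rwG (a^2) (c^2) m (-(x:ℤ)) =
      (2*a*c)^m * ∑ y ∈ Finset.range N, (c/a)^(y+1) * (rwB m ((y:ℤ)+1-x) - rwB m ((y:ℤ)+1+x)) := by
  induction m with
  | zero =>
    intro x hx
    cases x with
    | zero => simp [rwG]
    | succ x =>
      rw [rwG, if_neg (by push_cast; omega), Finset.sum_eq_single x]
      · simp only [rwB]
        rw [if_pos (by push_cast; ring), if_neg (by push_cast; omega)]; simp
      · intro b _ hb
        simp only [rwB]
        rw [if_neg (by push_cast; omega), if_neg (by push_cast; omega)]; simp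
      · intro h; simp at h; omega
  | succ m ih =>
    intro x hx
    cases x with
    | zero => simp [rwG]
    | succ x =>
      rw [rwG, if_neg (by push_cast; omega)]
      have e3 : -((x+1 : ℕ):ℤ) + 1 = -(x:ℤ) := by push_cast; ring
      have e4 : -((x+1 : ℕ):ℤ) - 1 = -((x+2:ℕ):ℤ) := by push_cast; ring
      rw [e3, e4]
      have i1 := ih x (by omega)
      have i2 := ih (x+2) (by omega)
      have hs : ∑ y ∈ Finset.range N, (c/a)^(y+1) *
            (rwB (m+1) ((y:ℤ)+1-(x+1:ℕ)) - rwB (m+1) ((y:ℤ)+1+(x+1:ℕ))) =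
          (∑ y ∈ Finset.range N, (c/a)^(y+1) * (rwB m ((y:ℤ)+1-x) - rwB m ((y:ℤ)+1+x)) +
          ∑ y ∈ Finset.range N, (c/a)^(y+1) * (rwB m ((y:ℤ)+1-(x+2:ℕ)) - rwB m ((y:ℤ)+1+(x+2:ℕ))))/2 := by
        rw [← Finset.sum_add_distrib, Finset.sum_div]
        refine Finset.sum_congr rfl fun y _ => ?_
        simp only [rwB]
        have f1 : (y:ℤ)+1-(x+1:ℕ)-1 = (y:ℤ)+1-(x+2:ℕ) := by push_cast; ring
        have f2 : (y:ℤ)+1-(x+1:ℕ)+1 = (y:ℤ)+1-x := by push_cast; ring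
        have f3 : (y:ℤ)+1+(x+1:ℕ)-1 = (y:ℤ)+1+x := by push_cast; ring
        have f4 : (y:ℤ)+1+(x+1:ℕ)+1 = (y:ℤ)+1+(x+2:ℕ) := by push_cast; ring
        rw [f1, f2, f3, f4]; ring
      rw [hs, pow_succ (2*a*c)]
      have : (c/a)^(x+1) * (a^2 * rwG (a^2) (c^2) m (-(x:ℤ)) + c^2 * rwG (a^2) (c^2) m (-((x+2:ℕ):ℤ)))
        = a * c * ((c/a)^x * rwG (a^2) (c^2) m (-(x:ℤ)) +
            (c/a)^(x+2) * rwG (a^2) (c^2) m (-((x+2:ℕ):ℤ))) := by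
        rw [pow_succ, pow_add]
        set t := (c/a)^x
        field_simp
      rw [this, i1, i2]; ring

lemma rwG_bound {a c : ℝ} (ha : 0 < a) (hc : 0 < c) (hac : c < a) :
    ∃ D : ℝ, 0 < D ∧ ∀ m : ℕ, rwG (a^2) (c^2) m (-1) * (((m:ℝ)+1) * √((m:ℝ)+1)) ≤ D * (2*a*c)^m := by
  have hr0 : 0 < c/a := by positivity
  have hr1 : c/a < 1 := by rw [div_lt_one ha]; exact hac
  have hsum : Summable (fun y : ℕ => (2*((y:ℝ)+1)) * (c/a)^(y+1)) := by
    have h := summable_pow_mul_geometric_of_norm_lt_one (R := ℝ) 1 (r := c/a)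
      (by rw [Real.norm_of_nonneg hr0.le]; exact hr1)
    have h2 := ((summable_nat_add_iff 1).2 h).mul_left 2
    refine h2.congr fun y => ?_
    push_cast; ring
  set D := ∑' y : ℕ, (2*((y:ℝ)+1)) * (c/a)^(y+1) with hD
  have hD0 : 0 < D := by
    refine hsum.tsum_pos (fun y => by positivity) 0 (by positivity)
  refine ⟨D / (c/a), by positivity, fun m => ?_⟩
  have hf := rwG_formula ha hc (m+1) m 1 (by omega)
  simp only [pow_one, Nat.cast_one] at hf
  have hm : (0:ℝ) < (m:ℝ)+1 := by positivity
  have hle : (∑ y ∈ Finset.range (m+1), (c/a)^(y+1) * (rwB m ((y:ℤ)+1-1) - rwB m ((y:ℤ)+1+1)))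
      * (((m:ℝ)+1) * √((m:ℝ)+1)) ≤ D := by
    rw [Finset.sum_mul]
    refine le_trans (Finset.sum_le_sum fun y _ => ?_)
      (hsum.sum_le_tsum (Finset.range (m+1)) (fun y _ => by positivity))
    have hK := rwB_K m ((y:ℤ)+1)
    have hB : rwB (m+1) ((y:ℤ)+1) * √((m:ℝ)+1) ≤ 1 := by
      have h1 := rwB_sq (m+1) ((y:ℤ)+1)
      push_cast at h1
      refine abs_le_one_iff_mul_self_le_one.2 ?_ |> le_of_abs_le
      have := Real.mul_self_sqrt hm.le
      have h3 : 0 ≤ rwB (m+1) ((y:ℤ)+1)^2 := sq_nonneg _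
      calc _ = rwB (m+1) ((y:ℤ)+1)^2 * (√((m:ℝ)+1) * √((m:ℝ)+1)) := by ring
        _ = rwB (m+1) ((y:ℤ)+1)^2 * ((m:ℝ)+1) := by rw [this]
        _ ≤ 1 := by linarith
    calc _ = (c/a)^(y+1) * ((((m:ℝ)+1) * (rwB m ((y:ℤ)+1-1) - rwB m ((y:ℤ)+1+1))) * √((m:ℝ)+1)) := by ring
      _ = (2*((y:ℝ)+1)) * (c/a)^(y+1) * (rwB (m+1) ((y:ℤ)+1) * √((m:ℝ)+1)) := by
          rw [hK]; push_cast; ring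
      _ ≤ (2*((y:ℝ)+1)) * (c/a)^(y+1) * 1 := by gcongr
      _ = _ := mul_one _
  rw [div_mul_eq_mul_div, le_div_iff₀ hr0]
  calc _ = ((c/a) * rwG (a^2) (c^2) m (-1)) * (((m:ℝ)+1) * √((m:ℝ)+1)) := by ring
    _ = (2*a*c)^m * ((∑ y ∈ Finset.range (m+1), (c/a)^(y+1) * (rwB m ((y:ℤ)+1-1) - rwB m ((y:ℤ)+1+1)))
      * (((m:ℝ)+1) * √((m:ℝ)+1))) := by rw [hf]; ring
    _ ≤ (2*a*c)^m * D := by gcongr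
    _ = _ := by ring

lemma srw_shift [MeasurableSpace Ω] {P : Measure Ω} {X : ℕ → Ω → ℤ} {p q : ℝ}
    (hX : IsAsymmetricSRW P X p q) : IsAsymmetricSRW P (fun i => X (i+1)) p q := by
  obtain ⟨h1, h2, h3, h4⟩ := hX
  exact ⟨fun i => h1 _, h2.precomp (g := fun i => i+1) (add_left_injective 1), fun i => h3 _, fun i => h4 _⟩

lemma S_shift (X : ℕ → Ω → ℤ) (n : ℕ) (ω : Ω) :
    S X (n+1) ω = X 0 ω + S (fun i => X (i+1)) n ω := by
  simp only [S, Finset.sum_range_succ', add_comm]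

def rwE (X : ℕ → Ω → ℤ) (m : ℕ) (x : ℤ) : Set Ω :=
  {ω | ∀ i : ℕ, i ≤ m → x + S X i ω ≠ 0}

lemma rwE_meas {ms : MeasurableSpace Ω} {X : ℕ → Ω → ℤ} (h : ∀ i, Measurable[ms] (X i))
    (m : ℕ) (x : ℤ) : MeasurableSet[ms] (rwE X m x) := by
  have : rwE X m x = ⋂ i ∈ Set.Iic m, (S X i) ⁻¹' {z | x + z ≠ 0} := by
    ext ω; simp [rwE]
  rw [this]
  refine MeasurableSet.biInter (Set.to_countable _) fun i _ => ?_
  have hS : Measurable (S X i) := by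
    unfold S
    exact Finset.measurable_sum _ (fun j _ => h j)
  exact hS (MeasurableSet.of_discrete)

lemma rw_indep [MeasurableSpace Ω] {P : Measure Ω} [IsProbabilityMeasure P]
    {X : ℕ → Ω → ℤ} {p q : ℝ} (hX : IsAsymmetricSRW P X p q) (m : ℕ) (x z : ℤ) :
    P.real ({ω | X 0 ω = z} ∩ rwE (fun i => X (i+1)) m x) =
      P.real {ω | X 0 ω = z} * P.real (rwE (fun i => X (i+1)) m x) := by
  obtain ⟨h1, h2, -, -⟩ := hX
  have h := indep_iSup_of_disjoint (m := fun i => MeasurableSpace.comap (X i) inferInstance) (μ := P)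
    (fun i => (h1 i).comap_le) h2 (S := {0}) (T := {i | 1 ≤ i}) (by simp)
  have := (Indep_iff _ _ _).1 h ({ω | X 0 ω = z}) (rwE (fun i => X (i+1)) m x) ?_ ?_
  · simp only [measureReal_def, this, ENNReal.toReal_mul]
  · have : MeasurableSet[MeasurableSpace.comap (X 0) inferInstance] {ω | X 0 ω = z} :=
      ⟨{z}, MeasurableSet.of_discrete, rfl⟩
    exact (le_iSup₂_of_le (f := fun j (_ : j ∈ ({0} : Set ℕ)) =>
      MeasurableSpace.comap (X j) inferInstance) 0 (by simp) le_rfl) _ this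
  · refine rwE_meas (fun i => ?_) m x
    refine Measurable.mono (comap_measurable (X (i+1))) ?_ le_rfl
    exact le_iSup₂_of_le (f := fun j (_ : j ∈ {i | 1 ≤ i}) => MeasurableSpace.comap (X j) inferInstance)
      (i+1) (by simp) le_rfl

lemma rw_ae [MeasurableSpace Ω] {P : Measure Ω} [IsProbabilityMeasure P]
    {X : ℕ → Ω → ℤ} {p q : ℝ} (hp : 0 ≤ p) (hq : 0 ≤ q) (hpq : p + q = 1)
    (hX : IsAsymmetricSRW P X p q) : ∀ᵐ ω ∂P, X 0 ω = 1 ∨ X 0 ω = -1 := by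
  obtain ⟨h1, -, h3, h4⟩ := hX
  have hm : ∀ z, MeasurableSet {ω | X 0 ω = z} := fun z => h1 0 (MeasurableSet.of_discrete (s := {z}))
  have : P ({ω | X 0 ω = 1} ∪ {ω | X 0 ω = -1}) = 1 := by
    rw [measure_union _ (hm _), h3, h4, ← ENNReal.ofReal_add hp hq, hpq, ENNReal.ofReal_one]
    rw [Set.disjoint_left]; intro ω h h'
    simp only [Set.mem_setOf_eq] at h h'; omega
  exact (prob_compl_eq_zero_iff ((hm 1).union (hm (-1)))).2 this

lemma rw_step [MeasurableSpace Ω] {P : Measure Ω} [IsProbabilityMeasure P]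
    {X : ℕ → Ω → ℤ} {p q : ℝ} (hp : 0 ≤ p) (hq : 0 ≤ q) (hpq : p + q = 1)
    (hX : IsAsymmetricSRW P X p q) (m : ℕ) (x : ℤ) :
    P.real {ω | ∀ i : ℕ, 1 ≤ i → i ≤ m + 1 → x + S X i ω ≠ 0} =
      p * P.real (rwE (fun i => X (i+1)) m (x+1)) + q * P.real (rwE (fun i => X (i+1)) m (x-1)) := by
  have hae := rw_ae hp hq hpq hX
  have i1 := rw_indep hX m (x+1) 1
  have i2 := rw_indep hX m (x-1) (-1)
  obtain ⟨h1, -, h3, h4⟩ := hX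
  have hm : ∀ z, MeasurableSet {ω | X 0 ω = z} := fun z => h1 0 (MeasurableSet.of_discrete (s := {z}))
  have h3' : P.real {ω | X 0 ω = 1} = p := by rw [measureReal_def, h3, ENNReal.toReal_ofReal hp]
  have h4' : P.real {ω | X 0 ω = -1} = q := by rw [measureReal_def, h4, ENNReal.toReal_ofReal hq]
  rw [h3'] at i1
  rw [h4'] at i2
  rw [← i1, ← i2, ← measureReal_union]
  · refine measureReal_congr ?_
    filter_upwards [hae] with ω hω
    have key : ∀ z, X 0 ω = z → ((∀ i : ℕ, 1 ≤ i → i ≤ m + 1 → x + S X i ω ≠ 0) ↔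
        ∀ i : ℕ, i ≤ m → x + z + S (fun i => X (i+1)) i ω ≠ 0) := by
      intro z hz
      constructor
      · intro h i hi
        have := h (i+1) (by omega) (by omega)
        rw [S_shift, hz] at this
        omega
      · intro h i hi1 hi
        obtain ⟨j, rfl⟩ : ∃ j, i = j+1 := ⟨i-1, by omega⟩
        have := h j (by omega)
        rw [S_shift, hz]; omega
    refine propext ?_
    change (∀ i : ℕ, 1 ≤ i → i ≤ m + 1 → x + S X i ω ≠ 0) ↔
      ((X 0 ω = 1 ∧ ω ∈ rwE (fun i => X (i+1)) m (x+1)) ∨ (X 0 ω = -1 ∧ ω ∈ rwE (fun i => X (i+1)) m (x-1)))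
    rcases hω with h | h
    · rw [key _ h]; simp [h, rwE]
    · rw [key _ h]; simp [h, rwE, sub_eq_add_neg]
  · rw [Set.disjoint_left]; rintro ω ⟨h, -⟩ ⟨h', -⟩
    simp only [Set.mem_setOf_eq] at h h'; omega
  · exact (hm _).inter (rwE_meas (fun i => h1 _) _ _)

lemma rwE_eq [MeasurableSpace Ω] {P : Measure Ω} [IsProbabilityMeasure P]
    {p q : ℝ} (hp : 0 ≤ p) (hq : 0 ≤ q) (hpq : p + q = 1) (m : ℕ) :
    ∀ (X : ℕ → Ω → ℤ) (_ : IsAsymmetricSRW P X p q) (x : ℤ), P.real (rwE X m x) = rwG p q m x := by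
  induction m with
  | zero =>
    intro X hX x
    by_cases h : x = 0 <;> simp [rwE, rwG, S, h]
  | succ m ih =>
    intro X hX x
    by_cases h : x = 0
    · subst h
      have : rwE X (m+1) 0 = ∅ := by
        ext ω; simp only [rwE, Set.mem_setOf_eq, Set.mem_empty_iff_false, iff_false]
        intro h; exact h 0 (by omega) (by simp [S])
      rw [this, rwG_zero]; simp
    · have : rwE X (m+1) x = {ω | ∀ i : ℕ, 1 ≤ i → i ≤ m + 1 → x + S X i ω ≠ 0} := by
        ext ω; simp only [rwE, Set.mem_setOf_eq]
        constructor
        · intro h i _ hi; exact h i hi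
        · intro h' i hi
          rcases Nat.eq_zero_or_pos i with rfl | h0
          · simpa [S] using h
          · exact h' i h0 hi
      rw [this, rw_step hp hq hpq hX, ih _ (srw_shift hX), ih _ (srw_shift hX), rwG, if_neg h]

/-- The no-return probabilities `γ(n) = P(S_i ≠ 0, i = 1, …, n-1)` satisfy
`1 = γ(1) ≥ γ(2) ≥ ⋯ ≥ γ(n) ≥ ⋯ ≥ γ = 1 - 2q`, and
`0 ≤ γ(n) - γ ≤ C (4pq)^{n/2} / n^{3/2}` for some constant `C > 0`. -/
theorem gamma_n_properties
    [MeasurableSpace Ω] (P : Measure Ω) [IsProbabilityMeasure P]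
    (X : ℕ → Ω → ℤ) (p q : ℝ) (hq0 : 0 < q) (hq : q < 1/2) (hpq : p + q = 1)
    (hX : IsAsymmetricSRW P X p q)
    (gam : ℕ → ℝ)
    (hgam : ∀ n : ℕ, gam n = (P {ω | ∀ i : ℕ, 1 ≤ i → i ≤ n - 1 → S X i ω ≠ 0}).toReal) :
    gam 1 = 1 ∧
    (∀ n : ℕ, 1 ≤ n → gam (n + 1) ≤ gam n) ∧
    (∀ n : ℕ, 1 ≤ n → 1 - 2*q ≤ gam n) ∧
    ∃ C : ℝ, 0 < C ∧ ∀ n : ℕ, 1 ≤ n →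
      gam n - (1 - 2*q) ≤ C * (4*p*q) ^ ((n : ℝ)/2) / (n : ℝ) ^ ((3 : ℝ)/2) := by
  obtain ⟨a, ha, rfl⟩ : ∃ a : ℝ, 0 < a ∧ p = a^2 :=
    ⟨√p, Real.sqrt_pos.2 (by linarith), (Real.sq_sqrt (by linarith)).symm⟩
  obtain ⟨c, hc, rfl⟩ : ∃ c : ℝ, 0 < c ∧ q = c^2 :=
    ⟨√q, Real.sqrt_pos.2 (by linarith), (Real.sq_sqrt (by linarith)).symm⟩
  have hac : c < a := by
    by_contra h
    have := pow_le_pow_left₀ ha.le (not_lt.1 h) 2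
    linarith
  have g1 : gam 1 = 1 := by
    rw [hgam]
    have : {ω | ∀ i : ℕ, 1 ≤ i → i ≤ 1 - 1 → S X i ω ≠ 0} = Set.univ := by
      ext ω; simp only [Set.mem_setOf_eq, Set.mem_univ, iff_true]; intro i h h'; omega
    rw [this]; simp
  have gm : ∀ m : ℕ, gam (m+2) = (1 - 2*c^2) + 2 * c^2 * rwG (a^2) (c^2) m (-1) := by
    intro m
    rw [hgam]
    have h := rw_step (by positivity) (by positivity) hpq hX m 0
    simp only [zero_add, zero_sub] at h
    rw [rwE_eq (by positivity) (by positivity) hpq m _ (srw_shift hX),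
      rwE_eq (by positivity) (by positivity) hpq m _ (srw_shift hX)] at h
    have hd := rwG_dual (by positivity) hpq m 1
    simp only [Nat.cast_one, pow_one] at hd
    rw [hd] at h
    have e : m + 2 - 1 = m + 1 := rfl
    rw [e]
    refine h.trans ?_
    set B := rwG (a^2) (c^2) m (-1)
    have : a^2 * (c^2/a^2) = c^2 := by field_simp
    linear_combination (-1 + B) * this + hpq
  refine ⟨g1, ?_, ?_, ?_⟩
  · intro n hn
    rw [hgam, hgam]
    refine ENNReal.toReal_mono (measure_ne_top _ _) (measure_mono ?_)
    intro ω h i h1 h2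
    exact h i h1 (by omega)
  · intro n hn
    rcases Nat.lt_or_ge n 2 with h | h
    · obtain rfl : n = 1 := by omega
      rw [g1]; linarith
    · obtain ⟨m, rfl⟩ : ∃ m, n = m + 2 := ⟨n-2, by omega⟩
      rw [gm]
      have := rwG_nonneg (p := a^2) (q := c^2) (by positivity) (by positivity) m (-1)
      nlinarith [mul_nonneg hq0.le this]
  · obtain ⟨D, hD, hb⟩ := rwG_bound ha hc hac
    have hs : 0 < 2*a*c := by positivity
    have hpow : ∀ n : ℕ, (4*a^2*c^2) ^ ((n:ℝ)/2) = (2*a*c)^n := by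
      intro n
      have : 4*a^2*c^2 = (2*a*c)^(2:ℝ) := by rw [Real.rpow_two]; ring
      rw [this, ← Real.rpow_mul hs.le, ← Real.rpow_natCast]
      congr 1; ring
    have hn32 : ∀ x : ℝ, 0 < x → x ^ ((3:ℝ)/2) = x * √x := by
      intro x hx
      rw [Real.sqrt_eq_rpow, show (3:ℝ)/2 = 1 + 1/2 by norm_num, Real.rpow_add hx, Real.rpow_one]
    refine ⟨2*c^2/(2*a*c) + 2*c^2*(4*D)/(2*a*c)^2, by positivity, ?_⟩
    intro n hn
    have hn0 : (0:ℝ) < n := by exact_mod_cast hn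
    rw [hpow, hn32 _ hn0, le_div_iff₀ (by positivity), add_mul]
    rcases Nat.lt_or_ge n 2 with h | h
    · obtain rfl : n = 1 := by omega
      rw [g1]
      have e : 2*c^2/(2*a*c) * (2*a*c)^1 = 2*c^2 := by field_simp
      have : 0 ≤ 2*c^2*(4*D)/(2*a*c)^2 * (2*a*c)^1 := by positivity
      rw [e]; simp; linarith
    · obtain ⟨m, rfl⟩ : ∃ m, n = m + 2 := ⟨n-2, by omega⟩
      rw [gm]
      have hG := rwG_nonneg (p := a^2) (q := c^2) (by positivity) (by positivity) m (-1)
      have h1 := hb m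
      set B := rwG (a^2) (c^2) m (-1)
      have hm : (0:ℝ) ≤ m := Nat.cast_nonneg m
      have e : 2*c^2*(4*D)/(2*a*c)^2 * (2*a*c)^(m+2) = 2*c^2*(4*(D*(2*a*c)^m)) := by
        rw [pow_add]; field_simp
      have h0 : 0 ≤ 2*c^2/(2*a*c) * (2*a*c)^(m+2) := by positivity
      have hsq : √((m:ℝ)+2) ≤ 2 * √((m:ℝ)+1) := by
        rw [Real.sqrt_le_left (by positivity), mul_pow, Real.sq_sqrt (by positivity)]; linarith
      have h2 : ((m:ℝ)+2) * √((m:ℝ)+2) ≤ (2*((m:ℝ)+1)) * (2 * √((m:ℝ)+1)) := by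
        gcongr; linarith
      have h3 : B * (((m:ℝ)+2) * √((m:ℝ)+2)) ≤ 4 * (D*(2*a*c)^m) := by
        have := mul_le_mul_of_nonneg_left h2 hG
        linarith
      have h4 := mul_le_mul_of_nonneg_left h3 (by positivity : 0 ≤ 2*c^2)
      rw [e]
      push_cast
      linarith
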